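/- Let G be a finite simple graph, let g be a nonnegative integer-valued function on V(G), and let f, f' be positive integer-valued functions on V(G). Suppose that for every matching M of G there exists a spanning tree T of G with M ⊆ E(T) and deg_T(v) ≤ f'(v) for every vertex v. Then for every spanning subgraph F of G with g(v) ≤ deg_F(v) ≤ f(v) for every vertex v, there exists a connected spanning subgraph H of G with E(F) ⊆ E(H) and g(v) ≤ deg_H(v) ≤ f(v) + f'(v) − 1 for every vertex v. -/

import Mathlib

open scoped Classical

/-- A matching of `G`, viewed as a set of pairwise non-adjacent edges of `G`. -/
def SimpleGraph.IsMatchingSet {V : Type*} (G : SimpleGraph V) (M : Set (Sym2 V)) : Prop :=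
  M ⊆ G.edgeSet ∧ ∀ e ∈ M, ∀ e' ∈ M, e ≠ e' → ∀ v : V, v ∈ e → v ∉ e'

namespace SimpleGraph

variable {V : Type*}

lemma IsMatchingSet.mono {F G : SimpleGraph V} (h : F ≤ G) {M : Set (Sym2 V)}
    (hM : F.IsMatchingSet M) : G.IsMatchingSet M :=
  ⟨hM.1.trans (edgeSet_mono h), hM.2⟩

/-- Every finite graph has a matching whose uncovered vertices are independent. -/
lemma exists_isMatchingSet_uncovered_independent [Finite V] (F : SimpleGraph V) :
    ∃ M : Set (Sym2 V), F.IsMatchingSet M ∧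
      ∀ u v, F.Adj u v → (∀ e ∈ M, u ∉ e) → ∃ e ∈ M, v ∈ e := by
  obtain ⟨M, hM⟩ := (Set.toFinite {M : Set (Sym2 V) | F.IsMatchingSet M}).exists_maximal
    ⟨∅, by simp [IsMatchingSet]⟩
  refine ⟨M, hM.prop, fun u v huv hu => ?_⟩
  by_contra! hv
  have hins : F.IsMatchingSet (insert s(u, v) M) := by
    refine ⟨Set.insert_subset huv hM.prop.1, ?_⟩
    rintro e (rfl | he) e' (rfl | he') hne x hx hx'
    · exact hne rfl
    · rcases Sym2.mem_iff.1 hx with rfl | rfl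
      exacts [hu _ he' hx', hv _ he' hx']
    · rcases Sym2.mem_iff.1 hx' with rfl | rfl
      exacts [hu _ he hx, hv _ he hx]
    · exact hM.prop.2 e he e' he' hne x hx hx'
  exact hu _ (hM.le_of_ge hins (Set.subset_insert _ _) (Set.mem_insert _ _))
    (Sym2.mem_mk_left u v)

/-- In a connected graph, a new edge `vu` can be exchanged for some old edge `vw`. -/
lemma Connected.exists_exchange {K : SimpleGraph V} (hK : K.Connected) {v u : V} (hvu : v ≠ u) :
    ∃ w, K.Adj v w ∧ (K.deleteEdges {s(v, w)} ⊔ edge v u).Connected := by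
  obtain ⟨p, hp⟩ := (hK v u).exists_isPath
  cases p with
  | nil => exact (hvu rfl).elim
  | @cons _ w _ hvw q =>
    rw [Walk.cons_isPath_iff] at hp
    refine ⟨w, hvw, ?_⟩
    set K' := K.deleteEdges {s(v, w)} ⊔ edge v u with hK'
    have hwu : K'.Reachable w u := by
      refine ⟨q.transfer K' fun e he => ?_⟩
      refine edgeSet_mono (le_sup_left : K.deleteEdges {s(v, w)} ≤ K') ?_
      rw [edgeSet_deleteEdges]
      refine ⟨q.edges_subset_edgeSet he, ?_⟩
      rintro rfl
      exact hp.2 (q.fst_mem_support_of_mem_edges he)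
    have huv : K'.Adj v u := by simp [hK', edge_adj, hvu]
    have hvw' : K'.Reachable v w := huv.reachable.trans hwu.symm
    have hadj : ∀ a b, K.Adj a b → K'.Reachable a b := by
      intro a b hab
      by_cases he : s(a, b) = s(v, w)
      · rcases Sym2.eq_iff.1 he with ⟨rfl, rfl⟩ | ⟨rfl, rfl⟩
        exacts [hvw', hvw'.symm]
      · refine Adj.reachable (Or.inl ?_)
        rw [deleteEdges_adj]
        exact ⟨hab, he⟩
    have := hK.nonempty
    refine ⟨fun a b => ?_⟩
    obtain ⟨r⟩ := hK a b
    induction r with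
    | nil => rfl
    | cons h _ ih => exact (hadj _ _ h).trans ih

/-- If `U` is an independent set of non-isolated vertices of `F`, then edges of a connected graph
`T` can be exchanged for edges of `F` so that every vertex of `U` has a `T`-edge that is in `F`
or is dropped. -/
lemma Connected.exists_connected_forall_exists_adj {T F : SimpleGraph V} (hT : T.Connected)
    (U : Finset V) (hU : ∀ v ∈ U, ∃ u, u ∉ U ∧ F.Adj v u) :
    ∃ K : SimpleGraph V, K.Connected ∧ K \ F ≤ T ∧
      ∀ v ∈ U, ∃ w, T.Adj v w ∧ ¬ (K \ F).Adj v w := by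
  suffices h : ∀ B ⊆ U, ∃ K : SimpleGraph V, K.Connected ∧ K \ F ≤ T ∧
      (∀ v ∈ U, v ∉ B → ∀ w, K.Adj v w → T.Adj v w) ∧
      ∀ v ∈ B, ∃ w, T.Adj v w ∧ ¬ (K \ F).Adj v w by
    obtain ⟨K, hK, hKT, -, h⟩ := h U subset_rfl
    exact ⟨K, hK, hKT, h⟩
  intro B
  induction B using Finset.induction_on with
  | empty => exact fun _ => ⟨T, hT, sdiff_le, fun _ _ _ _ h => h, by simp⟩
  | insert v B hvB ih =>
    intro hB
    rw [Finset.insert_subset_iff] at hB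
    obtain ⟨K, hK, hKT, hout, hin⟩ := ih hB.2
    by_cases hv : ∃ w, T.Adj v w ∧ ¬ (K \ F).Adj v w
    · refine ⟨K, hK, hKT, fun x hx hxB => hout x hx fun h => hxB (Finset.mem_insert_of_mem h), ?_⟩
      intro x hx
      rcases Finset.mem_insert.1 hx with rfl | hx
      exacts [hv, hin x hx]
    · push Not at hv
      obtain ⟨u, huU, hvu⟩ := hU v hB.1
      obtain ⟨w, hvw, hK'⟩ := hK.exists_exchange hvu.ne
      have hTw : T.Adj v w := hout v hB.1 hvB w hvw
      have hFw : ¬ F.Adj v w := (hv w hTw).2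
      have hle : (K.deleteEdges {s(v, w)} ⊔ edge v u) \ F ≤ K \ F := by
        rintro a b ⟨hab | hab, hF⟩
        · exact ⟨(deleteEdges_le _) hab, hF⟩
        · rcases ((edge_adj _ _ _ _).1 hab).1 with ⟨rfl, rfl⟩ | ⟨rfl, rfl⟩
          exacts [(hF hvu).elim, (hF hvu.symm).elim]
      refine ⟨_, hK', hle.trans hKT, ?_, ?_⟩
      · intro x hx hxB y hxy
        rw [Finset.mem_insert, not_or] at hxB
        rcases hxy with hxy | hxy
        · exact hout x hx hxB.2 y (deleteEdges_le _ hxy)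
        · rcases ((edge_adj _ _ _ _).1 hxy).1 with ⟨rfl, -⟩ | ⟨-, rfl⟩
          · exact (hxB.1 rfl).elim
          · rcases ((edge_adj _ _ _ _).1 hxy).1 with ⟨rfl, -⟩ | ⟨rfl, -⟩
            exacts [(hxB.1 rfl).elim, (huU hx).elim]
      · intro x hx
        rcases Finset.mem_insert.1 hx with rfl | hx
        · refine ⟨w, hTw, ?_⟩
          rintro ⟨h | h, -⟩
          · rw [deleteEdges_adj] at h
            exact h.2 rfl
          · rcases ((edge_adj _ _ _ _).1 h).1 with ⟨-, rfl⟩ | ⟨rfl, -⟩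
            exacts [hFw hvu, huU hB.1]
        · obtain ⟨y, hy, hxy⟩ := hin x hx
          exact ⟨y, hy, fun h => hxy (hle h)⟩

end SimpleGraph

/-- If every matching of `G` can be extended to a spanning `f'`-tree, then every
`(g,f)`-factor of `G` can be extended to a connected `(g, f + f' - 1)`-factor. -/
theorem connected_factor_of_matchings_extend {V : Type*} [Fintype V]
    (G : SimpleGraph V) (g f f' : V → ℤ)
    (hg0 : ∀ v, 0 ≤ g v) (hf1 : ∀ v, 1 ≤ f v) (hf'1 : ∀ v, 1 ≤ f' v)
    (hext : ∀ M : Set (Sym2 V), G.IsMatchingSet M →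
      ∃ T : SimpleGraph V, T ≤ G ∧ T.IsTree ∧ M ⊆ T.edgeSet ∧
        ∀ v, (T.degree v : ℤ) ≤ f' v) :
    ∀ F : SimpleGraph V, F ≤ G →
      (∀ v, g v ≤ (F.degree v : ℤ) ∧ (F.degree v : ℤ) ≤ f v) →
      ∃ H : SimpleGraph V, H ≤ G ∧ H.Connected ∧ F.edgeSet ⊆ H.edgeSet ∧
        ∀ v, g v ≤ (H.degree v : ℤ) ∧ (H.degree v : ℤ) ≤ f v + f' v - 1 := by
  intro F hFG hF
  obtain ⟨M, hM, hind⟩ := F.exists_isMatchingSet_uncovered_independent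
  obtain ⟨T, hTG, hT, hMT, hTdeg⟩ := hext M (hM.mono hFG)
  let U : Finset V := Finset.univ.filter fun v => (∃ u, F.Adj v u) ∧ ∀ e ∈ M, v ∉ e
  have hU : ∀ v ∈ U, ∃ u, u ∉ U ∧ F.Adj v u := by
    intro v hv
    obtain ⟨⟨u, hvu⟩, hvM⟩ := (Finset.mem_filter.1 hv).2
    obtain ⟨e, he, hue⟩ := hind v u hvu hvM
    exact ⟨u, fun hu => (Finset.mem_filter.1 hu).2.2 e he hue, hvu⟩
  obtain ⟨K, hK, hKT, hKU⟩ := hT.connected.exists_connected_forall_exists_adj U hU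
  have hmiss : ∀ v u, F.Adj v u → ∃ w, T.Adj v w ∧ ¬ (K \ F).Adj v w := by
    intro v u hvu
    by_cases hv : ∀ e ∈ M, v ∉ e
    · exact hKU v (Finset.mem_filter.2 ⟨Finset.mem_univ v, ⟨u, hvu⟩, hv⟩)
    · push Not at hv
      obtain ⟨e, he, w, rfl⟩ := hv
      exact ⟨w, hMT he, fun h => h.2 (hM.1 he)⟩
  obtain ⟨H, hFH, hKH, hsub⟩ : ∃ H : SimpleGraph V, F ≤ H ∧ K ≤ H ∧
      ∀ v w, H.Adj v w → F.Adj v w ∨ (K \ F).Adj v w := by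
    refine ⟨F ⊔ K, le_sup_left, le_sup_right, fun v w h => ?_⟩
    by_cases hvw : F.Adj v w
    exacts [Or.inl hvw, Or.inr ⟨h.resolve_left hvw, hvw⟩]
  refine ⟨H, ?_, hK.mono hKH, SimpleGraph.edgeSet_mono hFH, fun v => ⟨?_, ?_⟩⟩
  · intro a b h
    exact (hsub a b h).elim (fun h => hFG h) fun h => hTG (hKT h)
  · refine (hF v).1.trans ?_
    exact_mod_cast SimpleGraph.degree_le_of_le hFH
  · have h1 := (hF v).2
    have h2 := hTdeg v
    have h3 := hf1 v
    by_cases hv : ∃ u, F.Adj v u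
    · obtain ⟨u, hvu⟩ := hv
      obtain ⟨w, hTw, hKw⟩ := hmiss v u hvu
      have hnb : H.neighborFinset v ⊆
          F.neighborFinset v ∪ (T.neighborFinset v).erase w := by
        intro x hx
        simp only [Finset.mem_union, Finset.mem_erase, SimpleGraph.mem_neighborFinset] at hx ⊢
        refine (hsub v x hx).imp_right fun h => ⟨?_, hKT h⟩
        rintro rfl
        exact hKw h
      have hle := (Finset.card_le_card hnb).trans (Finset.card_union_le _ _)
      have herase := Finset.card_erase_add_one ((T.mem_neighborFinset v w).2 hTw)
      simp only [SimpleGraph.card_neighborFinset_eq_degree] at hle herase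
      omega
    · push Not at hv
      have hnb : H.neighborFinset v ⊆ T.neighborFinset v := by
        intro x hx
        rw [SimpleGraph.mem_neighborFinset] at hx ⊢
        exact hKT ((hsub v x hx).resolve_left (hv x))
      have hle := Finset.card_le_card hnb
      simp only [SimpleGraph.card_neighborFinset_eq_degree] at hle
      omega
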